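/- Maximum principle for the 1D Schrödinger equation with nonnegative potential: if u ∈ C([a,b]) is a weak solution of (1/2)u'' = q·u on (a,b) with q ≥ 0 bounded measurable and u(a) = u(b) = 0, then u ≡ 0 on [a,b]. -/

import Mathlib

open Real Set MeasureTheory intervalIntegral

lemma three_pt (a b : ℝ) (hab : a < b)
    (q : ℝ → ℝ) (hqnn : ∀ y, 0 ≤ q y)
    (u : ℝ → ℝ) (hc : Continuous u)
    (hweak : ∀ φ : ℝ → ℝ, ContDiff ℝ (⊤ : ℕ∞) φ → HasCompactSupport φ →
      tsupport φ ⊆ Ioo a b →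
      ∫ y in a..b, u y * ((1 / 2) * deriv (deriv φ) y) =
        ∫ y in a..b, q y * u y * φ y)
    (c d p r x : ℝ) (hac : a ≤ c) (hdb : d ≤ b) (hcp : c < p) (hrd : r < d)
    (hx : x ∈ Icc p r) (hpos : ∀ y ∈ Ioo c d, 0 ≤ u y) : u x ≤ max (u p) (u r) := by
  set m := min (p - c) (d - r) with hm
  have hm0 : 0 < m := lt_min (by linarith) (by linarith)
  have hmp : m ≤ p - c := min_le_left _ _
  have hmr : m ≤ d - r := min_le_right _ _
  let φ : ℕ → ContDiffBump (0 : ℝ) := fun n =>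
    ⟨m / (n + 3), m / (n + 2), by positivity, by
      apply div_lt_div_of_pos_left hm0 <;> [positivity; linarith]⟩
  have hrm : ∀ n, (φ n).rOut < m := fun n => by
    show m / ((n : ℝ) + 2) < m
    have : (0 : ℝ) ≤ n := Nat.cast_nonneg n
    rw [div_lt_iff₀ (by positivity)]
    nlinarith
  have hlim : Filter.Tendsto (fun n => (φ n).rOut) Filter.atTop (nhds 0) := by
    show Filter.Tendsto (fun n : ℕ => m / ((n : ℝ) + 2)) Filter.atTop (nhds 0)
    exact Filter.Tendsto.div_atTop tendsto_const_nhds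
      (Filter.tendsto_atTop_add_const_right _ _ tendsto_natCast_atTop_atTop)
  let v : ℕ → ℝ → ℝ := fun n =>
    convolution ((φ n).normed volume) u (ContinuousLinearMap.lsmul ℝ ℝ) volume
  have hv : ∀ z, Filter.Tendsto (fun n => v n z) Filter.atTop (nhds (u z)) := fun z =>
    ContDiffBump.convolution_tendsto_right_of_continuous hlim hc z
  have hconv : ∀ n, ConvexOn ℝ (Icc p r) (v n) := by
    intro n
    set ρ := (φ n).normed volume with hρ
    have hρs : ContDiff ℝ (⊤ : ℕ∞) ρ := (φ n).contDiff_normed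
    have hρc : HasCompactSupport ρ := (φ n).hasCompactSupport_normed
    have hρ1 : ContDiff ℝ (⊤ : ℕ∞) (deriv ρ) := by
      exact ((contDiff_infty_iff_deriv (𝕜 := ℝ)).1 hρs).2
    have hli : LocallyIntegrable u volume := hc.locallyIntegrable
    have hd1 : ∀ z, HasDerivAt (v n)
        (convolution (deriv ρ) u (ContinuousLinearMap.lsmul ℝ ℝ) volume z) z := fun z =>
      hρc.hasDerivAt_convolution_left _ (hρs.of_le (by exact_mod_cast le_top)) hli z
    have hd2 : ∀ z, HasDerivAt (convolution (deriv ρ) u (ContinuousLinearMap.lsmul ℝ ℝ) volume)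
        (convolution (deriv (deriv ρ)) u (ContinuousLinearMap.lsmul ℝ ℝ) volume z) z := fun z =>
      hρc.deriv.hasDerivAt_convolution_left _ (hρ1.of_le (by exact_mod_cast le_top)) hli z
    have hdv : deriv (v n) = convolution (deriv ρ) u (ContinuousLinearMap.lsmul ℝ ℝ) volume :=
      funext fun z => (hd1 z).deriv
    apply convexOn_of_deriv2_nonneg (convex_Icc _ _)
    · exact fun z _ => (hd1 z).continuousAt.continuousWithinAt
    · exact fun z _ => (hd1 z).differentiableAt.differentiableWithinAt
    · rw [hdv]
      exact fun z _ => (hd2 z).differentiableAt.differentiableWithinAt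
    · intro z hz
      have hz' : z ∈ Icc p r := interior_subset hz
      have : deriv^[2] (v n) z = deriv (deriv (v n)) z := rfl
      rw [this, hdv, (hd2 z).deriv, convolution_eq_swap]
      set ψ : ℝ → ℝ := fun y => ρ (z - y) with hψ
      have hψs : ContDiff ℝ (⊤ : ℕ∞) ψ := hρs.comp (contDiff_const.sub contDiff_id)
      have hψ2 : deriv (deriv ψ) = fun y => deriv (deriv ρ) (z - y) := by
        have h1 : deriv ψ = fun y => - deriv ρ (z - y) := by
          funext y
          exact deriv_comp_const_sub ρ z y
        rw [h1]
        funext y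
        have := deriv_comp_const_sub (deriv ρ) z y
        rw [deriv.fun_neg, this, neg_neg]
      have hsupp : tsupport ψ ⊆ Metric.closedBall z (φ n).rOut := by
        apply closure_minimal _ Metric.isClosed_closedBall
        intro y hy
        have : z - y ∈ Function.support ρ := hy
        rw [hρ, (φ n).support_normed_eq] at this
        simp only [Metric.mem_ball, dist_zero_right, Metric.mem_closedBall] at this ⊢
        rw [dist_comm, Real.dist_eq]
        exact this.le
      have hball : Metric.closedBall z (φ n).rOut ⊆ Ioo c d := by
        rw [Real.closedBall_eq_Icc]
        have := hrm n
        intro y hy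
        exact ⟨by linarith [hy.1, hz'.1], by linarith [hy.2, hz'.2]⟩
      have hψc : HasCompactSupport ψ :=
        (isCompact_closedBall z (φ n).rOut).of_isClosed_subset (isClosed_tsupport _) hsupp
      have hcd : Ioo c d ⊆ Ioo a b := Ioo_subset_Ioo hac hdb
      have key := hweak ψ hψs hψc ((hsupp.trans hball).trans hcd)
      have hnn : 0 ≤ ∫ y in a..b, q y * u y * ψ y := by
        apply intervalIntegral.integral_nonneg_of_forall hab.le
        intro y
        by_cases hy : y ∈ tsupport ψ
        · exact mul_nonneg (mul_nonneg (hqnn y) (hpos y (hball (hsupp hy))))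
            ((φ n).nonneg_normed _)
        · rw [image_eq_zero_of_notMem_tsupport hy, mul_zero]
      rw [← key, intervalIntegral.integral_of_le hab.le,
        setIntegral_eq_integral_of_forall_compl_eq_zero] at hnn
      · have e : (fun y => u y * (1 / 2 * deriv (deriv ψ) y)) =
            fun y => (1 / 2) * (deriv (deriv ρ) (z - y) * u y) := by
          rw [hψ2]; funext y; ring
        rw [e, MeasureTheory.integral_const_mul] at hnn
        simp only [ContinuousLinearMap.lsmul_apply, smul_eq_mul]
        linarith
      · intro y hy
        have h0 : y ∉ tsupport ψ := fun h =>
          hy (Ioo_subset_Ioc_self (hcd (hball (hsupp h))))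
        have h2 : y ∉ tsupport (deriv (deriv ψ)) := fun h =>
          h0 (tsupport_deriv_subset (𝕜 := ℝ) (tsupport_deriv_subset (𝕜 := ℝ) h))
        rw [image_eq_zero_of_notMem_tsupport h2]; ring
  have hpr : p ≤ r := hx.1.trans hx.2
  exact le_of_tendsto_of_tendsto' (hv x) ((hv p).max (hv r)) fun n =>
    (hconv n).le_max_of_mem_Icc (left_mem_Icc.2 hpr) (right_mem_Icc.2 hpr) hx

lemma max_nonpos (a b : ℝ) (hab : a < b)
    (q : ℝ → ℝ) (hqnn : ∀ y, 0 ≤ q y)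
    (u : ℝ → ℝ) (hc : Continuous u) (hua : u a = 0) (hub : u b = 0)
    (hweak : ∀ φ : ℝ → ℝ, ContDiff ℝ (⊤ : ℕ∞) φ → HasCompactSupport φ →
      tsupport φ ⊆ Ioo a b →
      ∫ y in a..b, u y * ((1 / 2) * deriv (deriv φ) y) =
        ∫ y in a..b, q y * u y * φ y) :
    ∀ x ∈ Icc a b, u x ≤ 0 := by
  intro x hx
  by_contra! hpos
  obtain ⟨c, ⟨⟨hac, hcx⟩, hc0⟩, hcmax⟩ :=
    ((isCompact_Icc (a := a) (b := x)).inter_right (isClosed_Iic.preimage hc)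
      (t := u ⁻¹' Iic 0)).exists_isGreatest ⟨a, ⟨le_rfl, hx.1⟩, hua.le⟩
  obtain ⟨d, ⟨⟨hxd, hdb⟩, hd0⟩, hdmin⟩ :=
    ((isCompact_Icc (a := x) (b := b)).inter_right (isClosed_Iic.preimage hc)
      (t := u ⁻¹' Iic 0)).exists_isLeast ⟨b, ⟨hx.2, le_rfl⟩, hub.le⟩
  have hc0' : u c ≤ 0 := hc0
  have hd0' : u d ≤ 0 := hd0
  have hcx' : c < x := lt_of_le_of_ne hcx (by rintro rfl; linarith)
  have hxd' : x < d := lt_of_le_of_ne hxd (by rintro rfl; linarith)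
  have hnn : ∀ y ∈ Ioo c d, 0 ≤ u y := by
    intro y hy
    by_contra! h
    rcases le_total y x with h1 | h1
    · exact absurd (hcmax ⟨⟨hac.trans hy.1.le, h1⟩, h.le⟩) (not_le.2 hy.1)
    · exact absurd (hdmin ⟨⟨h1, hy.2.le.trans hdb⟩, h.le⟩) (not_le.2 hy.2)
  obtain ⟨p, hp1, hp2⟩ := (((hc.continuousAt (x := c)).eventually_lt_const
    (lt_of_le_of_lt hc0' hpos)).filter_mono nhdsWithin_le_nhds |>.and
      (Ioo_mem_nhdsGT hcx')).exists
  obtain ⟨r, hr1, hr2⟩ := (((hc.continuousAt (x := d)).eventually_lt_const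
    (lt_of_le_of_lt hd0' hpos)).filter_mono nhdsWithin_le_nhds |>.and
      (Ioo_mem_nhdsLT hxd')).exists
  have := three_pt a b hab q hqnn u hc hweak c d p r x hac hdb hp2.1 hr2.2
    ⟨hp2.2.le, hr2.1.le⟩ hnn
  exact absurd this (not_le.2 (max_lt hp1 hr1))

/-- maximum principle: a continuous weak solution of
`(1/2)u'' = q u` on `(a,b)` with `q ≥ 0` bounded measurable and zero boundary
values vanishes identically on `[a,b]`. -/
theorem stmt18 (a b : ℝ) (hab : a < b)
    (q : ℝ → ℝ) (hqm : Measurable q) (hqnn : ∀ y, 0 ≤ q y)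
    (hqbdd : ∃ C, ∀ y, q y ≤ C)
    (u : ℝ → ℝ) (hc : ContinuousOn u (Icc a b)) (hua : u a = 0) (hub : u b = 0)
    (hweak : ∀ φ : ℝ → ℝ, ContDiff ℝ (⊤ : ℕ∞) φ → HasCompactSupport φ →
      tsupport φ ⊆ Ioo a b →
      ∫ y in a..b, u y * ((1 / 2) * deriv (deriv φ) y) =
        ∫ y in a..b, q y * u y * φ y) :
    ∀ x ∈ Icc a b, u x = 0 := by
  set U : ℝ → ℝ := IccExtend hab.le ((Icc a b).domRestrict u) with hU
  have hUc : Continuous U := (continuousOn_iff_continuous_domRestrict.1 hc).Icc_extend'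
  have hUe : ∀ y ∈ Icc a b, U y = u y := fun y hy => by
    rw [hU, IccExtend_of_mem _ _ hy]; rfl
  have hUa : U a = 0 := by rw [hUe a (left_mem_Icc.2 hab.le), hua]
  have hUb : U b = 0 := by rw [hUe b (right_mem_Icc.2 hab.le), hub]
  have hw : ∀ φ : ℝ → ℝ, ContDiff ℝ (⊤ : ℕ∞) φ → HasCompactSupport φ →
      tsupport φ ⊆ Ioo a b →
      ∫ y in a..b, U y * ((1 / 2) * deriv (deriv φ) y) =
        ∫ y in a..b, q y * U y * φ y := by
    intro φ h1 h2 h3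
    have := hweak φ h1 h2 h3
    rw [intervalIntegral.integral_congr (g := fun y => u y * ((1 / 2) * deriv (deriv φ) y)),
      this]
    · apply intervalIntegral.integral_congr
      intro y hy
      rw [uIcc_of_le hab.le] at hy
      simp only [hUe y hy]
    · intro y hy
      rw [uIcc_of_le hab.le] at hy
      simp only [hUe y hy]
  intro x hx
  have A := max_nonpos a b hab q hqnn U hUc hUa hUb hw x hx
  have B := max_nonpos a b hab q hqnn (fun y => - U y) hUc.neg (by simp [hUa]) (by simp [hUb])
    (by
      intro φ h1 h2 h3
      have := hw φ h1 h2 h3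
      simp only [neg_mul, mul_neg, intervalIntegral.integral_neg]
      rw [this]) x hx
  rw [← hUe x hx]
  linarith
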